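/- arXiv:2501.04233 — 3 statements merged into one kernel-verified Lean document; each statement's English description precedes it below -/
import Mathlib

section
/- Let p be an odd prime and n a positive integer with p^n ≡ 3 (mod 4), and let χ be the quadratic character of the finite field F_{p^n}. Then the sum over all x in F_{p^n} of χ(x·(x − 1/2)·(x² − x + 1/2)) equals −1 − χ(2)·λ_{p,n}, where λ_{p,n} denotes the sum over all x in F_{p^n} of χ(x·(x² − 2x − 1)). -/
section QuadraticCharSums

variable {F : Type*} [Field F] [Fintype F] [DecidableEq F]

theorem quadraticChar_mul_sq_right (a : F) {c : F} (hc : c ≠ 0) :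
    quadraticChar F (a * c ^ 2) = quadraticChar F a := by
  rw [map_mul, quadraticChar_sq_one' hc, mul_one]

theorem card_filter_sq_sub_mul_add_eq_zero (hF : ringChar F ≠ 2) (t b : F) :
    (({x : F | x ^ 2 - t * x + b = 0} : Finset F).card : ℤ) =
      quadraticChar F (t ^ 2 - 4 * b) + 1 := by
  have h2 : (2 : F) ≠ 0 := Ring.two_ne_zero hF
  rw [← quadraticChar_card_sqrts hF, Nat.cast_inj]
  refine Finset.card_bij' (fun x _ => 2 * x - t) (fun y _ => (y + t) / 2) ?_ ?_ ?_ ?_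
  · intro x hx
    simp only [Finset.mem_filter, Finset.mem_univ, true_and] at hx
    simp only [Set.mem_toFinset, Set.mem_ofPred_eq]
    linear_combination 4 * hx
  · intro y hy
    simp only [Set.mem_toFinset, Set.mem_ofPred_eq] at hy
    simp only [Finset.mem_filter, Finset.mem_univ, true_and]
    field_simp
    linear_combination hy
  · intro x _
    field_simp
    ring
  · intro y _
    field_simp
    ring

/-- The character sums attached to two 2-isogenous elliptic curves agree. -/
theorem sum_quadraticChar_two_isogeny (hF : ringChar F ≠ 2) (a : F) {b : F} (hb : b ≠ 0) :
    ∑ x : F, quadraticChar F (x * (x ^ 2 + a * x + b)) =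
      ∑ x : F, quadraticChar F (x * (x ^ 2 - 2 * a * x + (a ^ 2 - 4 * b))) := by
  calc ∑ x : F, quadraticChar F (x * (x ^ 2 + a * x + b))
      = ∑ x : F with x ≠ 0, quadraticChar F (x + b / x + a) := by
        rw [Finset.sum_filter]
        refine Finset.sum_congr rfl fun x _ => ?_
        by_cases hx : x = 0
        · simp [hx]
        · rw [if_pos hx, ← quadraticChar_mul_sq_right (x + b / x + a) hx]
          congr 1
          field_simp
          ring
    _ = ∑ t : F, ∑ x : F with x ≠ 0 ∧ x + b / x = t, quadraticChar F (x + b / x + a) := by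
        rw [← Finset.sum_fiberwise _ (fun x : F => x + b / x)]
        simp only [Finset.filter_filter]
    _ = ∑ t : F, (quadraticChar F (t ^ 2 - 4 * b) + 1) * quadraticChar F (t + a) := by
        refine Finset.sum_congr rfl fun t _ => ?_
        rw [← card_filter_sq_sub_mul_add_eq_zero hF, ← nsmul_eq_mul, ← Finset.sum_const]
        refine Finset.sum_congr ?_ ?_
        · ext x
          simp only [Finset.mem_filter, Finset.mem_univ, true_and]
          constructor
          · rintro ⟨hx, h⟩
            field_simp at h
            linear_combination h
          · intro h
            have hx : x ≠ 0 := by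
              rintro rfl
              exact hb (by linear_combination h)
            refine ⟨hx, ?_⟩
            field_simp
            linear_combination h
        · intro x hx
          have h := (Finset.mem_filter.mp hx).2
          have hx0 : x ≠ 0 := by
            rintro rfl
            exact hb (by linear_combination h)
          congr 2
          field_simp
          linear_combination h
    _ = ∑ t : F, quadraticChar F ((t + a) * (t ^ 2 - 4 * b)) := by
        have h0 : ∑ t : F, quadraticChar F (t + a) = 0 := by
          rw [← quadraticChar_sum_zero hF]
          exact Equiv.sum_comp (Equiv.addRight a) fun t => quadraticChar F t
        simp only [add_mul, one_mul, Finset.sum_add_distrib, h0, add_zero]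
        refine Finset.sum_congr rfl fun t _ => ?_
        rw [← map_mul]
        congr 1
        ring
    _ = ∑ x : F, quadraticChar F (x * (x ^ 2 - 2 * a * x + (a ^ 2 - 4 * b))) := by
        refine Fintype.sum_equiv (Equiv.addRight a) _ _ fun t => ?_
        rw [Equiv.coe_addRight]
        congr 1
        ring

theorem sum_quadraticChar_quartic (hF : ringChar F ≠ 2) :
    ∑ x : F, quadraticChar F (x * (x - 1/2) * (x^2 - x + 1/2)) =
      -1 + ∑ x : F, quadraticChar F (x * (x ^ 2 + (-2) * x + 2)) := by
  have h2 : (2 : F) ≠ 0 := Ring.two_ne_zero hF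
  have hsub : ∑ x : F, quadraticChar F (x * (x ^ 2 + (-2) * x + 2)) =
      ∑ y : F, quadraticChar F ((2 - y) * (y ^ 2 - 2 * y + 2)) := by
    refine Fintype.sum_equiv (Equiv.subLeft (2 : F)) _ _ fun y => ?_
    rw [Equiv.subLeft_apply]
    congr 1
    ring
  have hpt (y : F) : quadraticChar F (y⁻¹ * (y⁻¹ - 1/2) * (y⁻¹^2 - y⁻¹ + 1/2)) =
      (if y = 0 then -1 else 0) + quadraticChar F ((2 - y) * (y ^ 2 - 2 * y + 2)) := by
    by_cases hy : y = 0
    · have h4 : quadraticChar F (2 * 2) = 1 := by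
        rw [← sq, quadraticChar_sq_one' h2]
      simp [hy, h4, -map_mul]
    · rw [if_neg hy, zero_add,
        ← quadraticChar_mul_sq_right _ (mul_ne_zero h2 (pow_ne_zero 2 hy))]
      congr 1
      field_simp
      ring
  rw [hsub, ← Equiv.sum_comp (Equiv.inv F)]
  simp only [Equiv.inv_apply, hpt, Finset.sum_add_distrib, Finset.sum_ite_eq',
    Finset.mem_univ, if_true]

end QuadraticCharSums

theorem stmt_4 (p n : ℕ) (hp : p.Prime) (hodd : p ≠ 2) (hn : 0 < n)
    (h3 : p ^ n % 4 = 3)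
    (F : Type*) [Field F] [Fintype F] [DecidableEq F]
    (hcard : Fintype.card F = p ^ n) :
    ∑ x : F, quadraticChar F (x * (x - 1/2) * (x^2 - x + 1/2)) =
      -1 - quadraticChar F 2 * ∑ x : F, quadraticChar F (x * (x^2 - 2*x - 1)) := by
  have hF : ringChar F ≠ 2 := by
    intro h
    have := FiniteField.even_card_of_char_two h
    omega
  have h2 : (2 : F) ≠ 0 := Ring.two_ne_zero hF
  have hneg : quadraticChar F (-1) = -1 := by
    rw [quadraticChar_neg_one hF, hcard, ZMod.χ₄_nat_three_mod_four h3]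
  rw [sum_quadraticChar_quartic hF, sum_quadraticChar_two_isogeny hF _ h2, sub_eq_add_neg]
  congr 1
  rw [← neg_mul (quadraticChar F 2), Finset.mul_sum]
  symm
  refine Fintype.sum_equiv (Equiv.mulLeft₀ (-2 : F) (neg_ne_zero.mpr h2)) _ _ fun x => ?_
  rw [← neg_one_mul (quadraticChar F 2), ← hneg, ← map_mul, ← map_mul,
    ← quadraticChar_mul_sq_right _ h2, Equiv.mulLeft₀_apply]
  congr 1
  ring
end

section
/- Let p be an odd prime and n a positive integer with p^n ≡ 3 (mod 4), and let f₁ : F_{p^n} → F_{p^n} be given by f₁(x) = x^{(p^n+3)/2} + x². Then for every a ∈ F_{p^n}\{0}, the equation f₁(x+a) − f₁(x) = 0 has exactly (p^n + 1)/4 solutions x in F_{p^n}, i.e., δ_{f₁}(a,0) = (p^n + 1)/4. -/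
theorem sum_quadraticChar_mul_quadraticChar_add {F : Type*} [Field F] [Fintype F] [DecidableEq F]
    (hF : ringChar F ≠ 2) {a : F} (ha : a ≠ 0) :
    ∑ x : F, quadraticChar F x * quadraticChar F (x + a) = -1 := by
  have hpt : ∀ x : F, quadraticChar F x * quadraticChar F (x + a) =
      quadraticChar F (1 + a * x⁻¹) - if x = 0 then 1 else 0 := by
    intro x
    by_cases hx : x = 0
    · simp [hx]
    · have h : x + a = x * (1 + a * x⁻¹) := by field_simp
      rw [h, map_mul, ← mul_assoc, ← sq, quadraticChar_sq_one hx]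
      simp [hx]
  have hbij : ∑ x : F, quadraticChar F (1 + a * x⁻¹) = 0 := by
    rw [← quadraticChar_sum_zero hF]
    exact Equiv.sum_comp
      (((Equiv.inv F).trans (Equiv.mulLeft₀ a ha)).trans (Equiv.addLeft 1)) (quadraticChar F)
  simp_rw [hpt, Finset.sum_sub_distrib, hbij]
  simp

theorem four_mul_card_quadraticChar_ne_one {F : Type*} [Field F] [Fintype F] [DecidableEq F]
    (hF : ringChar F ≠ 2) (hneg : quadraticChar F (-1) = -1) {a : F} (ha : a ≠ 0) :
    4 * ((Finset.univ.filter fun x : F =>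
      quadraticChar F x ≠ 1 ∧ quadraticChar F (x + a) ≠ 1).card : ℤ) = Fintype.card F + 1 := by
  have hna : quadraticChar F (-a) = -quadraticChar F a := by
    rw [← neg_one_mul, map_mul, hneg, neg_one_mul]
  have hpt : ∀ x : F,
      4 * (if quadraticChar F x ≠ 1 ∧ quadraticChar F (x + a) ≠ 1 then (1 : ℤ) else 0) =
      1 - quadraticChar F x - quadraticChar F (x + a) +
        quadraticChar F x * quadraticChar F (x + a) +
        (if x = 0 then 1 - quadraticChar F a else 0) +
        (if x = -a then 1 + quadraticChar F a else 0) := by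
    intro x
    by_cases hx : x = 0
    · subst hx
      have : (0 : F) ≠ -a := by simpa [eq_comm] using ha
      rcases quadraticChar_dichotomy ha with h | h <;> simp [h, this]
    by_cases hxa : x = -a
    · subst hxa
      rcases quadraticChar_dichotomy ha with h | h <;> simp [h, ha, hna]
    have hxa' : x + a ≠ 0 := fun h => hxa (eq_neg_of_add_eq_zero_left h)
    rcases quadraticChar_dichotomy hx with h | h <;>
      rcases quadraticChar_dichotomy hxa' with h' | h' <;> simp [h, h', hx, hxa]
  have hshift : ∑ x : F, quadraticChar F (x + a) = 0 := by
    rw [← quadraticChar_sum_zero hF]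
    exact Equiv.sum_comp (Equiv.addRight a) (quadraticChar F)
  rw [Finset.card_filter, Nat.cast_sum, Finset.mul_sum]
  push_cast
  simp_rw [hpt, Finset.sum_add_distrib, Finset.sum_sub_distrib, quadraticChar_sum_zero hF, hshift,
    sum_quadraticChar_mul_quadraticChar_add hF ha]
  simp
  ring

theorem stmt_13 (p n : ℕ) (hp : p.Prime) (hodd : p ≠ 2) (hn : 0 < n)
    (h3 : p ^ n % 4 = 3)
    (F : Type*) [Field F] [Fintype F] [DecidableEq F]
    (hcard : Fintype.card F = p ^ n)
    (f₁ : F → F) (hf₁ : ∀ x, f₁ x = x ^ ((p ^ n + 3) / 2) + x ^ 2) :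
    ∀ a : F, a ≠ 0 →
      Set.ncard {x : F | f₁ (x + a) - f₁ x = 0} = (p ^ n + 1) / 4 := by
  intro a ha
  have hF : ringChar F ≠ 2 := by
    intro h
    have := FiniteField.even_card_of_char_two h
    omega
  have h2 : (2 : F) ≠ 0 := Ring.two_ne_zero hF
  have hneg : quadraticChar F (-1) = -1 := by
    rw [quadraticChar_neg_one_iff_not_isSquare, FiniteField.isSquare_neg_one_iff, hcard]
    simp [h3]
  have hf : ∀ x, f₁ x = if quadraticChar F x = 1 then 2 * x ^ 2 else 0 := by
    intro x
    have he : (p ^ n + 3) / 2 = Fintype.card F / 2 + 2 := by omega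
    rw [hf₁, he, pow_add, ← quadraticChar_eq_pow_of_char_ne_two' hF]
    by_cases hx : x = 0
    · simp [hx]
    rcases quadraticChar_dichotomy hx with h | h
    · simp [h]; ring
    · simp [h]
  have hset : {x : F | f₁ (x + a) - f₁ x = 0} = ↑(Finset.univ.filter fun x : F =>
      quadraticChar F x ≠ 1 ∧ quadraticChar F (x + a) ≠ 1) := by
    ext x
    simp only [Set.mem_ofPred_eq, Finset.coe_filter, Finset.mem_univ, true_and, hf]
    have hne : ∀ y : F, quadraticChar F y = 1 → 2 * y ^ 2 ≠ 0 := by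
      rintro y hy h
      have : y = 0 := by simpa [h2] using h
      simp [this] at hy
    by_cases h : quadraticChar F x = 1 <;> by_cases h' : quadraticChar F (x + a) = 1
    · simp only [h, h', if_true, ne_eq, not_true_eq_false, and_self, iff_false]
      intro heq
      have hsq : (x + a) ^ 2 = x ^ 2 := mul_left_cancel₀ h2 (sub_eq_zero.mp heq)
      rcases sq_eq_sq_iff_eq_or_eq_neg.mp hsq with h1 | h1
      · exact ha (by simpa using h1)
      · rw [h1, ← neg_one_mul, map_mul, hneg, h] at h'
        norm_num at h'
    · rw [if_pos h, if_neg h', zero_sub, neg_eq_zero]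
      exact iff_of_false (hne x h) fun hc => hc.1 h
    · rw [if_neg h, if_pos h', sub_zero]
      exact iff_of_false (hne _ h') fun hc => hc.2 h'
    · rw [if_neg h, if_neg h', sub_zero]
      exact iff_of_true rfl ⟨h, h'⟩
  rw [hset, Set.ncard_coe_finset]
  have := four_mul_card_quadraticChar_ne_one hF hneg ha
  rw [hcard] at this
  omega
end

section
/- Let p be an odd prime and n a positive integer with p^n ≡ 3 (mod 4), and let f₁ : F_{p^n} → F_{p^n} be given by f₁(x) = x^{(p^n+3)/2} + x². Then the number ω₀ of pairs (a,b) ∈ F_{p^n} × F_{p^n} with δ_{f₁}(a,b) = 0 equals (1/8)·(p^n − 1)·(3p^n + 3 + (χ(2) − 1)·λ_{p,n}), where χ is the quadratic character of F_{p^n} and λ_{p,n} = Σ_{x ∈ F_{p^n}} χ(x(x² − 2x − 1)). -/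
section QuadraticCharacterSums

variable {F : Type*} [Field F] [Fintype F] [DecidableEq F]

/-- The function equal to `2 * x ^ 2` on nonzero squares and to `0` elsewhere. -/
def twiceSqOnSquares (x : F) : F := if quadraticChar F x = 1 then 2 * x ^ 2 else 0

theorem quadraticChar_sq_mul {c : F} (hc : c ≠ 0) (u : F) :
    quadraticChar F (c ^ 2 * u) = quadraticChar F u := by
  rw [map_mul, quadraticChar_sq_one' hc, one_mul]

theorem quadraticChar_inv (y : F) : quadraticChar F y⁻¹ = quadraticChar F y := by
  by_cases hy : y = 0
  · simp [hy]
  · rw [← quadraticChar_sq_mul hy y⁻¹]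
    congr 1
    field_simp

theorem quadraticChar_values (x : F) :
    quadraticChar F x = 0 ∨ quadraticChar F x = 1 ∨ quadraticChar F x = -1 := by
  by_cases hx : x = 0
  · exact Or.inl (by simp [hx])
  · exact Or.inr (quadraticChar_dichotomy hx)

omit [DecidableEq F] in
theorem ringChar_ne_two_of_card_mod_four (h : Fintype.card F % 4 = 3) : ringChar F ≠ 2 := by
  intro h2
  have := FiniteField.even_card_iff_char_two.mp h2
  omega

theorem quadraticChar_neg_of_card_mod_four (h : Fintype.card F % 4 = 3) (x : F) :
    quadraticChar F (-x) = -quadraticChar F x := by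
  have h1 : quadraticChar F (-1) = -1 := by
    rw [quadraticChar_neg_one_iff_not_isSquare, FiniteField.isSquare_neg_one_iff]
    simpa using h
  rw [neg_eq_neg_one_mul, map_mul, h1, neg_one_mul]

theorem sum_quadraticChar_of_odd (h : Fintype.card F % 4 = 3) (g : F → F)
    (hg : ∀ x, g (-x) = -g x) : ∑ x, quadraticChar F (g x) = 0 := by
  have := Equiv.sum_comp (Equiv.neg F) fun x => quadraticChar F (g x)
  simp only [Equiv.neg_apply, hg, quadraticChar_neg_of_card_mod_four h,
    Finset.sum_neg_distrib] at this
  linarith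

theorem sum_quadraticChar_add (h2 : ringChar F ≠ 2) (c : F) :
    ∑ x, quadraticChar F (x + c) = 0 := by
  rw [← quadraticChar_sum_zero h2]
  exact Equiv.sum_comp (Equiv.addRight c) fun x => quadraticChar F x

theorem sum_quadraticChar_mul_add (h2 : ringChar F ≠ 2) {c : F} (hc : c ≠ 0) :
    ∑ x, quadraticChar F (x * (x + c)) = -1 := by
  have key : ∀ x : F, quadraticChar F (x⁻¹ * (x⁻¹ + c)) =
      quadraticChar F (c * (x + c⁻¹)) - if x = 0 then 1 else 0 := by
    intro x
    by_cases hx : x = 0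
    · simp [hx, hc]
    · rw [← quadraticChar_sq_mul hx]
      simp only [hx, if_false, sub_zero]
      congr 1
      field_simp
      ring
  have := Equiv.sum_comp (Equiv.inv F) fun x => quadraticChar F (x * (x + c))
  simp only [Equiv.inv_apply] at this
  rw [← this]
  simp only [key, Finset.sum_sub_distrib, map_mul, ← Finset.mul_sum, sum_quadraticChar_add h2]
  simp

theorem sum_quadraticChar_sq_sub_one (h2 : ringChar F ≠ 2) :
    ∑ x : F, quadraticChar F (x ^ 2 - 1) = -1 := by
  rw [← sum_quadraticChar_mul_add h2 (Ring.two_ne_zero h2)]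
  rw [← Equiv.sum_comp (Equiv.addRight (1 : F)) fun x => quadraticChar F (x ^ 2 - 1)]
  refine Finset.sum_congr rfl fun x _ => ?_
  congr 1
  simp only [Equiv.coe_addRight]
  ring

theorem sum_comp_sq (h2 : ringChar F ≠ 2) (g : F → ℤ) :
    ∑ x : F, g (x ^ 2) = ∑ z, (1 + quadraticChar F z) * g z := by
  rw [← Finset.sum_fiberwise Finset.univ (fun x : F => x ^ 2)]
  refine Finset.sum_congr rfl fun z _ => ?_
  have hz := quadraticChar_card_sqrts h2 z
  rw [Finset.sum_congr rfl (g := fun _ => g z) (by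
    intro x hx
    rw [(Finset.mem_filter.mp hx).2]), Finset.sum_const, nsmul_eq_mul, add_comm, ← hz]
  congr 3
  ext x
  simp

/-- The two-isogeny `y² = x (x² + a x + b)` to `y² = x (x² - 2 a x + a² - 4 b)` preserves the
number of points. -/
theorem sum_quadraticChar_isogeny (h2 : ringChar F ≠ 2) (a : F) {b : F} (hb : b ≠ 0) :
    ∑ x, quadraticChar F (x * (x ^ 2 + a * x + b)) =
      ∑ x, quadraticChar F (x * (x ^ 2 - 2 * a * x + (a ^ 2 - 4 * b))) := by
  have h20 : (2 : F) ≠ 0 := Ring.two_ne_zero h2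
  have hx : ∀ x : F, quadraticChar F (x * (x ^ 2 + a * x + b)) =
      ∑ t, if x ^ 2 + b = t * x then quadraticChar F (t + a) else 0 := by
    intro x
    by_cases hx : x = 0
    · simp [hx, hb]
    · rw [Finset.sum_eq_single (x + b / x)]
      · rw [if_pos (by field_simp), ← quadraticChar_sq_mul hx (x + b / x + a)]
        congr 1
        field_simp
        ring
      · intro t _ ht
        rw [if_neg]
        rintro h
        apply ht
        field_simp
        linear_combination -h
      · simp
  have ht : ∀ t : F, (∑ x : F, if x ^ 2 + b = t * x then quadraticChar F (t + a) else 0) =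
      quadraticChar F (t + a) + quadraticChar F ((t + a) * (t ^ 2 - 4 * b)) := by
    intro t
    have hz := quadraticChar_card_sqrts h2 (t ^ 2 - 4 * b)
    rw [← Finset.sum_filter, Finset.sum_const, nsmul_eq_mul, map_mul]
    have hc : (Finset.univ.filter fun x : F => x ^ 2 + b = t * x).card =
        ({x : F | x ^ 2 = t ^ 2 - 4 * b}.toFinset).card := by
      refine Finset.card_nbij' (fun x => 2 * x - t) (fun x => (x + t) / 2) ?_ ?_ ?_ ?_
      · intro x hx
        simp at hx ⊢
        linear_combination 4 * hx
      · intro x hx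
        simp at hx ⊢
        field_simp
        linear_combination hx
      · intro x _
        field_simp
        ring
      · intro x _
        field_simp
        ring
    rw [hc, hz]
    ring
  simp only [hx]
  rw [Finset.sum_comm]
  simp only [ht, Finset.sum_add_distrib, sum_quadraticChar_add h2, zero_add]
  rw [← Equiv.sum_comp (Equiv.addRight (-a))]
  refine Finset.sum_congr rfl fun x _ => ?_
  congr 1
  simp only [Equiv.coe_addRight]
  ring

theorem sum_quadraticChar_add_one_mul_sq_add_one (h2 : ringChar F ≠ 2) :
    ∑ x : F, quadraticChar F ((x + 1) * (x ^ 2 + 1)) =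
      quadraticChar F (-2) * ∑ x : F, quadraticChar F (x * (x ^ 2 - 2 * x - 1)) := by
  have h20 : (2 : F) ≠ 0 := Ring.two_ne_zero h2
  rw [← Equiv.sum_comp (Equiv.addRight (-1 : F))]
  have h := sum_quadraticChar_isogeny h2 (-2) h20
  rw [← Equiv.sum_comp (Equiv.mulLeft₀ (-2 : F) (neg_ne_zero.mpr h20)) fun x =>
    quadraticChar F (x * (x ^ 2 - 2 * (-2) * x + ((-2) ^ 2 - 4 * 2)))] at h
  rw [Finset.mul_sum]
  refine Eq.trans (Finset.sum_congr rfl fun x _ => ?_) (h.trans (Finset.sum_congr rfl fun x _ => ?_))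
  · congr 1
    simp only [Equiv.coe_addRight]
    ring
  · rw [← map_mul, ← quadraticChar_sq_mul h20 (-2 * _)]
    congr 1
    simp only [Equiv.mulLeft₀_apply]
    ring

theorem sum_quadraticChar_mul_add_one_mul_sq_add_one :
    ∑ x : F, quadraticChar F (x * (x + 1) * (x ^ 2 + 1)) =
      (∑ x : F, quadraticChar F ((x + 1) * (x ^ 2 + 1))) - 1 := by
  have key : ∀ x : F, quadraticChar F (x⁻¹ * (x⁻¹ + 1) * (x⁻¹ ^ 2 + 1)) =
      quadraticChar F ((x + 1) * (x ^ 2 + 1)) - if x = 0 then 1 else 0 := by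
    intro x
    by_cases hx : x = 0
    · simp [hx]
    · rw [← quadraticChar_sq_mul (pow_ne_zero 2 hx)]
      simp only [hx, if_false, sub_zero]
      congr 1
      field_simp
      ring
  rw [← Equiv.sum_comp (Equiv.inv F)]
  simp only [Equiv.inv_apply, key, Finset.sum_sub_distrib]
  simp

theorem sum_quadraticChar_pow_four_sub_one (h : Fintype.card F % 4 = 3) :
    ∑ x : F, quadraticChar F (x ^ 4 - 1) = -1 := by
  have h2 := ringChar_ne_two_of_card_mod_four h
  have := sum_comp_sq h2 fun z => quadraticChar F (z ^ 2 - 1)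
  simp only [← pow_mul, one_add_mul, Finset.sum_add_distrib, ← map_mul,
    sum_quadraticChar_sq_sub_one h2] at this
  rw [sum_quadraticChar_of_odd h (fun x => x * (x ^ 2 - 1)) (fun x => by ring)] at this
  simpa using this

end QuadraticCharacterSums

section DifferentialSpectrum

variable {F : Type*} [Field F] [Fintype F] [DecidableEq F]

/-- The condition on a nonzero square `y` for `2 * y ^ 2` to be missed by the derivative of
`twiceSqOnSquares` in direction `1`. -/
def MissesTwiceSq (y : F) : Prop :=
  quadraticChar F y = 1 ∧ quadraticChar F (y - 1) = 1 ∧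
    ¬(quadraticChar F (2 * (y ^ 2 - 1)) = 1 ∧ quadraticChar F (2 * (y ^ 2 + 1)) = 1)

/-- The condition on a nonzero square `y` for `-(2 * y ^ 2)` to be missed by the derivative of
`twiceSqOnSquares` in direction `1`. -/
def MissesNegTwiceSq (y : F) : Prop :=
  quadraticChar F y = 1 ∧ quadraticChar F (y + 1) = 1 ∧
    ¬(quadraticChar F (2 * (1 - y ^ 2)) = 1 ∧ quadraticChar F (-(2 * (y ^ 2 + 1))) = 1)

instance : DecidablePred (MissesTwiceSq (F := F)) := fun _ => by
  unfold MissesTwiceSq; infer_instance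

instance : DecidablePred (MissesNegTwiceSq (F := F)) := fun _ => by
  unfold MissesNegTwiceSq; infer_instance

theorem eq_of_sq_eq_of_quadraticChar_eq_one (h : Fintype.card F % 4 = 3) {x y : F}
    (hx : quadraticChar F x = 1) (hy : quadraticChar F y = 1) (hxy : x ^ 2 = y ^ 2) : x = y := by
  rcases sq_eq_sq_iff_eq_or_eq_neg.mp hxy with rfl | rfl
  · rfl
  · rw [quadraticChar_neg_of_card_mod_four h, hy] at hx
    norm_num at hx

theorem exists_sq_eq_of_quadraticChar_eq_one (h : Fintype.card F % 4 = 3) {b : F}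
    (hb : quadraticChar F b = 1) : ∃ y, quadraticChar F y = 1 ∧ y ^ 2 = b := by
  have hb0 : b ≠ 0 := by rintro rfl; simp at hb
  obtain ⟨s, rfl⟩ := (quadraticChar_one_iff_isSquare hb0).mp hb
  have hs : s ≠ 0 := by rintro rfl; simp at hb0
  rcases quadraticChar_dichotomy hs with h1 | h1
  · exact ⟨s, h1, by ring⟩
  · exact ⟨-s, by rw [quadraticChar_neg_of_card_mod_four h, h1, neg_neg], by ring⟩

theorem sq_add_sq_ne_zero (h : Fintype.card F % 4 = 3) {x y : F}
    (hy : quadraticChar F y = 1) : x ^ 2 + y ^ 2 ≠ 0 := by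
  intro h0
  have hy0 : y ≠ 0 := by rintro rfl; simp at hy
  have h1 := quadraticChar_sq_one' hy0
  rw [show y ^ 2 = -x ^ 2 by linear_combination h0, quadraticChar_neg_of_card_mod_four h,
    map_pow] at h1
  nlinarith [sq_nonneg (quadraticChar F x)]

theorem ne_of_missesTwiceSq (h : Fintype.card F % 4 = 3) {y : F} (hy : MissesTwiceSq y) (x : F) :
    twiceSqOnSquares (x + 1) - twiceSqOnSquares x ≠ 2 * y ^ 2 := by
  have h20 : (2 : F) ≠ 0 := Ring.two_ne_zero (ringChar_ne_two_of_card_mod_four h)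
  obtain ⟨h1, h2, h3⟩ := hy
  have hy0 : y ≠ 0 := by rintro rfl; simp at h1
  unfold twiceSqOnSquares
  intro hx
  split_ifs at hx with ha hb hb
  · have e : y ^ 2 = 2 * x + 1 := mul_left_cancel₀ h20 (by linear_combination -hx)
    apply h3
    rw [e, show 2 * (2 * x + 1 - 1) = 2 ^ 2 * x by ring,
      show 2 * (2 * x + 1 + 1) = 2 ^ 2 * (x + 1) by ring, quadraticChar_sq_mul h20,
      quadraticChar_sq_mul h20]
    exact ⟨hb, ha⟩
  · have e := eq_of_sq_eq_of_quadraticChar_eq_one h ha h1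
      (mul_left_cancel₀ h20 (by linear_combination hx))
    rw [← e] at h2
    exact hb (by simpa using h2)
  · exact sq_add_sq_ne_zero h h1 (mul_left_cancel₀ h20 (by linear_combination -hx) : x ^ 2 + y ^ 2 = 0)
  · exact mul_ne_zero h20 (pow_ne_zero 2 hy0) (by linear_combination -hx)

theorem ne_of_missesNegTwiceSq (h : Fintype.card F % 4 = 3) {y : F} (hy : MissesNegTwiceSq y)
    (x : F) : twiceSqOnSquares (x + 1) - twiceSqOnSquares x ≠ -(2 * y ^ 2) := by
  have h20 : (2 : F) ≠ 0 := Ring.two_ne_zero (ringChar_ne_two_of_card_mod_four h)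
  obtain ⟨h1, h2, h3⟩ := hy
  have hy0 : y ≠ 0 := by rintro rfl; simp at h1
  unfold twiceSqOnSquares
  intro hx
  split_ifs at hx with ha hb hb
  · have e : y ^ 2 = -(2 * x + 1) := mul_left_cancel₀ h20 (by linear_combination hx)
    apply h3
    rw [e, show 2 * (1 - -(2 * x + 1)) = 2 ^ 2 * (x + 1) by ring,
      show -(2 * (-(2 * x + 1) + 1)) = 2 ^ 2 * x by ring, quadraticChar_sq_mul h20,
      quadraticChar_sq_mul h20]
    exact ⟨ha, hb⟩
  · exact sq_add_sq_ne_zero h h1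
      (mul_left_cancel₀ h20 (by linear_combination hx) : (x + 1) ^ 2 + y ^ 2 = 0)
  · have e := eq_of_sq_eq_of_quadraticChar_eq_one h hb h1
      (mul_left_cancel₀ h20 (by linear_combination -hx))
    rw [← e] at h2
    exact ha h2
  · exact mul_ne_zero h20 (pow_ne_zero 2 hy0) (by linear_combination hx)

theorem exists_misses_of_forall_ne (h : Fintype.card F % 4 = 3) {b : F}
    (hb : ∀ x : F, twiceSqOnSquares (x + 1) - twiceSqOnSquares x ≠ b) :
    (∃ y, MissesTwiceSq y ∧ 2 * y ^ 2 = b) ∨ ∃ y, MissesNegTwiceSq y ∧ -(2 * y ^ 2) = b := by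
  have h20 : (2 : F) ≠ 0 := Ring.two_ne_zero (ringChar_ne_two_of_card_mod_four h)
  have hb0 : b ≠ 0 := by
    rintro rfl
    apply hb (-1)
    simp [twiceSqOnSquares, quadraticChar_neg_of_card_mod_four h]
  have hb2 : b / 2 ≠ 0 := div_ne_zero hb0 h20
  unfold twiceSqOnSquares at hb
  rcases quadraticChar_dichotomy hb2 with hc | hc
  · left
    obtain ⟨y, hy, hyb⟩ := exists_sq_eq_of_quadraticChar_eq_one h hc
    obtain rfl : 2 * y ^ 2 = b := by rw [hyb]; field_simp
    refine ⟨y, ⟨hy, ?_, ?_⟩, rfl⟩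
    · by_contra hc
      apply hb (y - 1)
      rw [sub_add_cancel, if_pos hy, if_neg hc, sub_zero]
    · rintro ⟨h1, h2⟩
      rw [show 2 * (y ^ 2 - 1) = 2 ^ 2 * ((y ^ 2 - 1) / 2) by field_simp,
        quadraticChar_sq_mul h20] at h1
      rw [show 2 * (y ^ 2 + 1) = 2 ^ 2 * ((y ^ 2 - 1) / 2 + 1) by field_simp; ring,
        quadraticChar_sq_mul h20] at h2
      apply hb ((y ^ 2 - 1) / 2)
      rw [if_pos h1, if_pos h2]
      field_simp
      ring
  · right
    rw [← neg_eq_iff_eq_neg, ← quadraticChar_neg_of_card_mod_four h] at hc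
    obtain ⟨y, hy, hyb⟩ := exists_sq_eq_of_quadraticChar_eq_one h hc
    obtain rfl : -(2 * y ^ 2) = b := by rw [hyb]; field_simp
    refine ⟨y, ⟨hy, ?_, ?_⟩, rfl⟩
    · by_contra hc
      apply hb y
      rw [if_neg hc, if_pos hy, zero_sub]
    · rintro ⟨h1, h2⟩
      rw [show 2 * (1 - y ^ 2) = 2 ^ 2 * (-(y ^ 2 + 1) / 2 + 1) by field_simp; ring,
        quadraticChar_sq_mul h20] at h1
      rw [show -(2 * (y ^ 2 + 1)) = 2 ^ 2 * (-(y ^ 2 + 1) / 2) by field_simp,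
        quadraticChar_sq_mul h20] at h2
      apply hb (-(y ^ 2 + 1) / 2)
      rw [if_pos h1, if_pos h2]
      field_simp
      ring

theorem card_missed_direction_one (h : Fintype.card F % 4 = 3) :
    ((Finset.univ.filter fun b : F =>
      ∀ x : F, twiceSqOnSquares (x + 1) - twiceSqOnSquares x ≠ b).card : ℤ) =
      (∑ y : F, if MissesTwiceSq y then 1 else 0) +
        ∑ y : F, if MissesNegTwiceSq y then 1 else 0 := by
  have h20 : (2 : F) ≠ 0 := Ring.two_ne_zero (ringChar_ne_two_of_card_mod_four h)
  have hset : (Finset.univ.filter fun b : F =>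
      ∀ x : F, twiceSqOnSquares (x + 1) - twiceSqOnSquares x ≠ b) =
      (Finset.univ.filter fun y : F => MissesTwiceSq y).image (fun y => 2 * y ^ 2) ∪
        (Finset.univ.filter fun y : F => MissesNegTwiceSq y).image fun y => -(2 * y ^ 2) := by
    ext b
    simp only [Finset.mem_filter, Finset.mem_univ, true_and, Finset.mem_union, Finset.mem_image]
    refine ⟨exists_misses_of_forall_ne h, ?_⟩
    rintro (⟨y, hy, rfl⟩ | ⟨y, hy, rfl⟩) x
    · exact ne_of_missesTwiceSq h hy x
    · exact ne_of_missesNegTwiceSq h hy x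
  rw [hset, Finset.card_union_of_disjoint, Finset.card_image_of_injOn,
    Finset.card_image_of_injOn]
  · simp
  · intro x hx y hy hxy
    simp only [Finset.coe_filter, Finset.mem_univ, true_and, Set.mem_ofPred_eq] at hx hy
    exact eq_of_sq_eq_of_quadraticChar_eq_one h hx.1 hy.1
      (mul_left_cancel₀ h20 (neg_injective hxy))
  · intro x hx y hy hxy
    simp only [Finset.coe_filter, Finset.mem_univ, true_and, Set.mem_ofPred_eq] at hx hy
    exact eq_of_sq_eq_of_quadraticChar_eq_one h hx.1 hy.1 (mul_left_cancel₀ h20 hxy)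
  · rw [Finset.disjoint_left]
    intro b hb hb'
    simp only [Finset.mem_filter, Finset.mem_univ, true_and, Finset.mem_image] at hb hb'
    obtain ⟨x, _, rfl⟩ := hb
    obtain ⟨y, hy, hxy⟩ := hb'
    exact sq_add_sq_ne_zero h hy.1
      (mul_left_cancel₀ h20 (by linear_combination -hxy) : x ^ 2 + y ^ 2 = 0)

theorem quadraticChar_values_near (h : Fintype.card F % 4 = 3) {y : F} (hy : y ≠ 0) :
    (quadraticChar F y = 1 ∨ quadraticChar F y = -1) ∧
      (quadraticChar F (y ^ 2 + 1) = 1 ∨ quadraticChar F (y ^ 2 + 1) = -1) ∧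
      (quadraticChar F (y - 1) = 0 → quadraticChar F y = 1 ∧
        quadraticChar F (y + 1) = quadraticChar F 2 ∧
        quadraticChar F (y ^ 2 + 1) = quadraticChar F 2) ∧
      (quadraticChar F (y + 1) = 0 → quadraticChar F y = -1) := by
  refine ⟨quadraticChar_dichotomy hy, quadraticChar_dichotomy ?_, fun hB => ?_, fun hC => ?_⟩
  · simpa using sq_add_sq_ne_zero (x := y) h (map_one (quadraticChar F))
  · obtain rfl : y = 1 := sub_eq_zero.mp (quadraticChar_eq_zero_iff.mp hB)
    norm_num
  · obtain rfl : y = -1 := eq_neg_of_add_eq_zero_left (quadraticChar_eq_zero_iff.mp hC)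
    simp [quadraticChar_neg_of_card_mod_four h]

theorem quadraticChar_sq_sub_one (y : F) :
    quadraticChar F (y ^ 2 - 1) = quadraticChar F (y - 1) * quadraticChar F (y + 1) := by
  rw [← map_mul]
  congr 1
  ring

theorem missesTwiceSq_iff (y : F) :
    MissesTwiceSq y ↔ quadraticChar F y = 1 ∧ quadraticChar F (y - 1) = 1 ∧
      ¬(quadraticChar F 2 * (quadraticChar F (y - 1) * quadraticChar F (y + 1)) = 1 ∧
        quadraticChar F 2 * quadraticChar F (y ^ 2 + 1) = 1) := by
  rw [MissesTwiceSq, map_mul, map_mul, quadraticChar_sq_sub_one]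

theorem missesNegTwiceSq_iff (h : Fintype.card F % 4 = 3) (y : F) :
    MissesNegTwiceSq y ↔ quadraticChar F y = 1 ∧ quadraticChar F (y + 1) = 1 ∧
      ¬(quadraticChar F 2 * -(quadraticChar F (y - 1) * quadraticChar F (y + 1)) = 1 ∧
        -(quadraticChar F 2 * quadraticChar F (y ^ 2 + 1)) = 1) := by
  rw [MissesNegTwiceSq, map_mul, quadraticChar_neg_of_card_mod_four h, map_mul, ← neg_sub,
    quadraticChar_neg_of_card_mod_four h, quadraticChar_sq_sub_one]

theorem missesNegTwiceSq_inv_iff (h : Fintype.card F % 4 = 3) {y : F} (hy : y ≠ 0) :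
    MissesNegTwiceSq y⁻¹ ↔ quadraticChar F y = 1 ∧
      quadraticChar F y * quadraticChar F (y + 1) = 1 ∧
      ¬(quadraticChar F 2 * (quadraticChar F (y - 1) * quadraticChar F (y + 1)) = 1 ∧
        -(quadraticChar F 2 * quadraticChar F (y ^ 2 + 1)) = 1) := by
  have h1 : quadraticChar F (y⁻¹ + 1) = quadraticChar F y * quadraticChar F (y + 1) := by
    rw [← map_mul, ← quadraticChar_sq_mul hy]
    congr 1
    field_simp
    ring
  have h2 : quadraticChar F (1 - y⁻¹ ^ 2) =
      quadraticChar F (y - 1) * quadraticChar F (y + 1) := by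
    rw [← map_mul, ← quadraticChar_sq_mul hy]
    congr 1
    field_simp
    ring
  have h3 : quadraticChar F (y⁻¹ ^ 2 + 1) = quadraticChar F (y ^ 2 + 1) := by
    rw [← quadraticChar_sq_mul hy]
    congr 1
    field_simp
    ring
  rw [MissesNegTwiceSq, map_mul, quadraticChar_neg_of_card_mod_four h, map_mul, h1, h2, h3,
    quadraticChar_inv]

theorem indicator_of_quadraticChar_two_eq_one (h : Fintype.card F % 4 = 3)
    (h2 : quadraticChar F 2 = 1) (y : F) :
    (8 * ((if MissesTwiceSq y then 1 else 0) + if MissesNegTwiceSq y⁻¹ then 1 else 0) : ℤ) =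
      3 + 3 * quadraticChar F y + quadraticChar F (y - 1) + quadraticChar F (y + 1)
        + quadraticChar F (y * (y + -1)) + quadraticChar F (y * (y + 1))
        - quadraticChar F (y ^ 2 - 1) - quadraticChar F (y * (y ^ 2 - 1))
        - if y = 0 then 4 else 0 := by
  by_cases hy : y = 0
  · simp [hy, MissesTwiceSq, MissesNegTwiceSq, quadraticChar_neg_of_card_mod_four h]
  obtain ⟨hA, hD, hB0, hC0⟩ := quadraticChar_values_near h hy
  have hB := quadraticChar_values (y - 1)
  have hC := quadraticChar_values (y + 1)
  simp only [missesTwiceSq_iff, missesNegTwiceSq_inv_iff h hy, map_mul, h2, ← sub_eq_add_neg,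
    quadraticChar_sq_sub_one, if_neg hy, one_mul] at *
  generalize quadraticChar F y = A at *
  generalize quadraticChar F (y - 1) = B at *
  generalize quadraticChar F (y + 1) = C at *
  generalize quadraticChar F (y ^ 2 + 1) = D at *
  rcases hA with rfl | rfl <;> rcases hB with rfl | rfl | rfl <;>
    rcases hC with rfl | rfl | rfl <;> rcases hD with rfl | rfl <;> simp_all

theorem indicator_of_quadraticChar_two_eq_neg_one (h : Fintype.card F % 4 = 3)
    (h2 : quadraticChar F 2 = -1) (y : F) :
    (8 * ((if MissesTwiceSq y then 1 else 0) + if MissesNegTwiceSq y then 1 else 0) : ℤ) =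
      3 + 3 * quadraticChar F y + quadraticChar F (y - 1) + 2 * quadraticChar F (y + 1)
        + quadraticChar F (y * (y + -1)) + 2 * quadraticChar F (y * (y + 1))
        - quadraticChar F ((y + 1) * (y ^ 2 + 1)) - quadraticChar F (y * (y + 1) * (y ^ 2 + 1))
        - quadraticChar F (y ^ 4 - 1) - quadraticChar F (y * (y ^ 4 - 1))
        - if y = 0 then 4 else 0 := by
  by_cases hy : y = 0
  · simp [hy, MissesTwiceSq, MissesNegTwiceSq, quadraticChar_neg_of_card_mod_four h]
  obtain ⟨hA, hD, hB0, hC0⟩ := quadraticChar_values_near h hy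
  have hB := quadraticChar_values (y - 1)
  have hC := quadraticChar_values (y + 1)
  have hE : quadraticChar F (y ^ 4 - 1) =
      quadraticChar F (y - 1) * quadraticChar F (y + 1) * quadraticChar F (y ^ 2 + 1) := by
    rw [← map_mul, ← map_mul]
    congr 1
    ring
  simp only [missesTwiceSq_iff, missesNegTwiceSq_iff h, map_mul, h2, ← sub_eq_add_neg,
    hE, if_neg hy, neg_one_mul] at hB0 hC0 ⊢
  clear hE h2 hy
  generalize quadraticChar F y = A at *
  generalize quadraticChar F (y - 1) = B at *
  generalize quadraticChar F (y + 1) = C at *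
  generalize quadraticChar F (y ^ 2 + 1) = D at *
  rcases hA with rfl | rfl <;> rcases hB with rfl | rfl | rfl <;>
    rcases hC with rfl | rfl | rfl <;> rcases hD with rfl | rfl <;>
    simp at hB0 hC0 ⊢

theorem eight_mul_card_missed_direction_one (h : Fintype.card F % 4 = 3) :
    8 * ((Finset.univ.filter fun b : F =>
      ∀ x : F, twiceSqOnSquares (x + 1) - twiceSqOnSquares x ≠ b).card : ℤ) =
      3 * Fintype.card F - 5 + (quadraticChar F 2 - 1) *
        ∑ x : F, quadraticChar F (x * (x ^ 2 - 2 * x - 1)) := by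
  have hr := ringChar_ne_two_of_card_mod_four h
  have h20 : (2 : F) ≠ 0 := Ring.two_ne_zero hr
  rw [card_missed_direction_one h]
  rcases quadraticChar_dichotomy h20 with h2 | h2
  · rw [← Equiv.sum_comp (Equiv.inv F) fun y => if MissesNegTwiceSq y then 1 else 0,
      ← Finset.sum_add_distrib, Finset.mul_sum]
    simp only [Equiv.inv_apply, indicator_of_quadraticChar_two_eq_one h h2]
    simp only [Finset.sum_add_distrib, Finset.sum_sub_distrib, ← Finset.mul_sum,
      quadraticChar_sum_zero hr, sub_eq_add_neg _ (1 : F), sum_quadraticChar_add hr,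
      sum_quadraticChar_mul_add hr one_ne_zero,
      sum_quadraticChar_mul_add hr (neg_ne_zero.mpr (one_ne_zero (α := F)))]
    simp only [← sub_eq_add_neg _ (1 : F), sum_quadraticChar_sq_sub_one hr]
    rw [sum_quadraticChar_of_odd h (fun x => x * (x ^ 2 - 1)) (fun x => by ring), h2]
    simp
    ring
  · rw [← Finset.sum_add_distrib, Finset.mul_sum]
    simp only [indicator_of_quadraticChar_two_eq_neg_one h h2]
    have hneg : quadraticChar F (-2) = 1 := by
      rw [quadraticChar_neg_of_card_mod_four h, h2, neg_neg]
    simp only [Finset.sum_add_distrib, Finset.sum_sub_distrib, ← Finset.mul_sum,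
      quadraticChar_sum_zero hr, sub_eq_add_neg _ (1 : F), sum_quadraticChar_add hr,
      sum_quadraticChar_mul_add hr one_ne_zero,
      sum_quadraticChar_mul_add hr (neg_ne_zero.mpr (one_ne_zero (α := F)))]
    simp only [← sub_eq_add_neg _ (1 : F), sum_quadraticChar_pow_four_sub_one h,
      sum_quadraticChar_mul_add_one_mul_sq_add_one, sum_quadraticChar_add_one_mul_sq_add_one hr]
    rw [sum_quadraticChar_of_odd h (fun x => x * (x ^ 4 - 1)) (fun x => by ring), h2, hneg]
    simp
    ring

theorem twiceSqOnSquares_mul {c : F} (hc : quadraticChar F c = 1) (x : F) :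
    twiceSqOnSquares (c * x) = c ^ 2 * twiceSqOnSquares x := by
  unfold twiceSqOnSquares
  rw [map_mul, hc, one_mul]
  split_ifs <;> ring

theorem forall_derivative_ne_iff {c : F} (hc : quadraticChar F c = 1)
    (b : F) : (∀ x : F, twiceSqOnSquares (x + c) - twiceSqOnSquares x ≠ c ^ 2 * b) ↔
      ∀ x : F, twiceSqOnSquares (x + 1) - twiceSqOnSquares x ≠ b := by
  have hc0 : c ≠ 0 := by rintro rfl; simp at hc
  rw [← (Equiv.mulLeft₀ c hc0).forall_congr_right]
  refine forall_congr' fun x => not_congr ?_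
  simp only [Equiv.mulLeft₀_apply]
  rw [show c * x + c = c * (x + 1) by ring, twiceSqOnSquares_mul hc, twiceSqOnSquares_mul hc,
    ← mul_sub, mul_right_inj' (pow_ne_zero 2 hc0)]

theorem forall_derivative_neg_ne_iff (a b : F) :
    (∀ x : F, twiceSqOnSquares (x + -a) - twiceSqOnSquares x ≠ -b) ↔
      ∀ x : F, twiceSqOnSquares (x + a) - twiceSqOnSquares x ≠ b := by
  rw [← (Equiv.addRight a).forall_congr_right]
  refine forall_congr' fun x => not_congr ?_
  simp only [Equiv.coe_addRight, add_neg_cancel_right]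
  rw [← neg_inj, neg_sub, neg_neg]

theorem card_missed_direction (h : Fintype.card F % 4 = 3) {a : F} (ha : a ≠ 0) :
    (Finset.univ.filter fun b : F =>
      ∀ x : F, twiceSqOnSquares (x + a) - twiceSqOnSquares x ≠ b).card =
    (Finset.univ.filter fun b : F =>
      ∀ x : F, twiceSqOnSquares (x + 1) - twiceSqOnSquares x ≠ b).card := by
  have hsq : a ^ 2 ≠ 0 := pow_ne_zero 2 ha
  symm
  rcases quadraticChar_dichotomy ha with hc | hc
  · refine Finset.card_equiv (Equiv.mulLeft₀ (a ^ 2) hsq) fun b => ?_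
    simp [- ne_eq, forall_derivative_ne_iff hc]
  · rw [← neg_eq_iff_eq_neg, ← quadraticChar_neg_of_card_mod_four h] at hc
    refine Finset.card_equiv (Equiv.mulLeft₀ (-a ^ 2) (neg_ne_zero.mpr hsq)) fun b => ?_
    have h1 := forall_derivative_ne_iff hc b
    rw [neg_sq, ← forall_derivative_neg_ne_iff, neg_neg, ← neg_mul] at h1
    simp [- ne_eq, - neg_mul, h1]

theorem card_missed (h : Fintype.card F % 4 = 3) :
    ((Finset.univ.filter fun ab : F × F =>
      ∀ x : F, twiceSqOnSquares (x + ab.1) - twiceSqOnSquares x ≠ ab.2).card : ℤ) =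
      (Fintype.card F - 1) * (1 + (Finset.univ.filter fun b : F =>
        ∀ x : F, twiceSqOnSquares (x + 1) - twiceSqOnSquares x ≠ b).card) := by
  have h0 : (Finset.univ.filter fun b : F =>
      ∀ x : F, twiceSqOnSquares (x + 0) - twiceSqOnSquares x ≠ b).card = Fintype.card F - 1 := by
    rw [← Finset.card_univ, ← Finset.card_erase_of_mem (Finset.mem_univ (0 : F))]
    congr 1
    ext b
    simp [eq_comm]
  rw [Finset.card_filter, Fintype.sum_prod_type]
  simp only [← Finset.card_filter]
  rw [← Finset.add_sum_erase _ _ (Finset.mem_univ (0 : F)), h0,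
    Finset.sum_congr rfl fun a ha => card_missed_direction h (Finset.ne_of_mem_erase ha),
    Finset.sum_const, Finset.card_erase_of_mem (Finset.mem_univ _), Finset.card_univ]
  rw [smul_eq_mul]
  push_cast [Nat.cast_sub (Fintype.card_pos (α := F) : 1 ≤ _)]
  ring

theorem pow_add_sq_eq_twiceSqOnSquares (h : Fintype.card F % 4 = 3) (x : F) :
    x ^ ((Fintype.card F + 3) / 2) + x ^ 2 = twiceSqOnSquares x := by
  have hr := ringChar_ne_two_of_card_mod_four h
  rw [show (Fintype.card F + 3) / 2 = Fintype.card F / 2 + 2 by omega, pow_add,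
    ← quadraticChar_eq_pow_of_char_ne_two' hr, twiceSqOnSquares]
  rcases quadraticChar_values x with hx | hx | hx
  · have : x = 0 := quadraticChar_eq_zero_iff.mp hx
    simp [this]
  · simp [hx]
    ring
  · simp [hx]

end DifferentialSpectrum

theorem stmt_15 (p n : ℕ) (hp : p.Prime) (hodd : p ≠ 2) (hn : 0 < n)
    (h3 : p ^ n % 4 = 3)
    (F : Type*) [Field F] [Fintype F] [DecidableEq F]
    (hcard : Fintype.card F = p ^ n)
    (f₁ : F → F) (hf₁ : ∀ x, f₁ x = x ^ ((p ^ n + 3) / 2) + x ^ 2) :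
    (Set.ncard {ab : F × F |
        Set.ncard {x : F | f₁ (x + ab.1) - f₁ x = ab.2} = 0} : ℚ) =
      1/8 * ((p : ℚ) ^ n - 1) * (3 * (p : ℚ) ^ n + 3 + (((quadraticChar F 2 : ℤ) : ℚ) - 1) * ((∑ x : F, quadraticChar F (x * (x ^ 2 - 2 * x - 1)) : ℤ) : ℚ)) := by
  rw [← hcard] at h3
  have hf : f₁ = twiceSqOnSquares := by
    funext x
    rw [hf₁, ← hcard, pow_add_sq_eq_twiceSqOnSquares h3]
  have hset : {ab : F × F | Set.ncard {x : F | f₁ (x + ab.1) - f₁ x = ab.2} = 0} =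
      (Finset.univ.filter fun ab : F × F =>
        ∀ x : F, twiceSqOnSquares (x + ab.1) - twiceSqOnSquares x ≠ ab.2 : Finset (F × F)) := by
    ext ab
    rw [Set.mem_ofPred_eq, Set.ncard_eq_zero, Set.eq_empty_iff_forall_notMem]
    simp [hf]
  have h1 := congrArg (Int.cast : ℤ → ℚ) (card_missed h3)
  have h2 := congrArg (Int.cast : ℤ → ℚ) (eight_mul_card_missed_direction_one h3)
  rw [hcard] at h1 h2
  rw [hset, Set.ncard_coe_finset]
  push_cast at h1 h2 ⊢
  rw [h1]
  linear_combination ((p : ℚ) ^ n - 1) / 8 * h2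
end
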